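/- arXiv:1403.3473 — 4 statements merged into one kernel-verified Lean document; each statement's English description precedes it below -/
import Mathlib

section
/- Let R be an infinite Dedekind domain with at most finitely many units, let K be its field of fractions, let L/K be a finite Galois extension of fields, and let O be the integral closure of R in L. Then O contains infinitely many prime ideals. -/
/-- An infinite domain with finitely many units has infinitely many maximal ideals. -/
theorem infinite_maximalSpectrum_of_finite_units (R : Type*) [CommRing R] [IsDomain R]
    [Infinite R] [Finite Rˣ] : Infinite (MaximalSpectrum R) := by
  by_contra h
  have : Finite (MaximalSpectrum R) := not_infinite_iff_finite.mp h
  have : Fintype (MaximalSpectrum R) := Fintype.ofFinite _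
  have hR : ¬ IsField R := fun hF ↦ by
    have hfin : (Set.univ : Set R).Finite :=
      ((Set.finite_range (Units.val : Rˣ → R)).insert 0).subset fun x _ ↦ by
        by_cases hx : x = 0
        · exact Or.inl hx
        · obtain ⟨y, hy⟩ := hF.mul_inv_cancel hx
          exact Or.inr ⟨(IsUnit.of_mul_eq_one y hy).unit, rfl⟩
    exact Set.infinite_univ hfin
  choose f hf hf0 using fun M : MaximalSpectrum R ↦
    Submodule.exists_mem_ne_zero_of_ne_bot (Ring.ne_bot_of_isMaximal_of_not_isField M.isMaximal hR)
  have hx0 : ∏ M, f M ≠ 0 := Finset.prod_ne_zero_iff.mpr fun M _ ↦ hf0 M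
  have hx : ∏ M, f M ∈ Ideal.jacobson (⊥ : Ideal R) := by
    refine Ideal.mem_sInf.mpr fun {I} hI ↦ ?_
    exact I.mem_of_dvd (Finset.dvd_prod_of_mem f (Finset.mem_univ ⟨I, hI.2⟩)) (hf ⟨I, hI.2⟩)
  have hunit := Ideal.mem_jacobson_bot.mp hx
  have hinj : Function.Injective fun y ↦ (hunit y).unit := fun y z hyz ↦
    mul_left_cancel₀ hx0 (add_right_cancel (congrArg Units.val hyz))
  have := Finite.of_injective _ hinj
  exact not_finite R


/-- Let `R` be an infinite Dedekind domain with at most finitely many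
units, `K` its field of fractions, `L/K` a finite Galois extension of fields, and
`O` the integral closure of `R` in `L`. Then `O` contains infinitely many prime
ideals. -/
theorem infinite_prime_ideals_of_integralClosure
    (R : Type*) [CommRing R] [IsDomain R] [IsDedekindDomain R] [Infinite R]
    (hu : Finite Rˣ)
    (K : Type*) [Field K] [Algebra R K] [IsFractionRing R K]
    (L : Type*) [Field L] [Algebra K L] [FiniteDimensional K L] [IsGalois K L]
    [Algebra R L] [IsScalarTower R K L] :
    {P : Ideal (integralClosure R L) | P.IsPrime}.Infinite := by
  have : FaithfulSMul R L := by
    rw [faithfulSMul_iff_algebraMap_injective, IsScalarTower.algebraMap_eq R K L]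
    exact (algebraMap K L).injective.comp (IsFractionRing.injective R K)
  have := infinite_maximalSpectrum_of_finite_units R
  have : Infinite (PrimeSpectrum R) :=
    .of_injective _ MaximalSpectrum.toPrimeSpectrum_injective
  have : Infinite (PrimeSpectrum (integralClosure R L)) :=
    .of_surjective _ (Algebra.IsIntegral.comap_surjective R _)
  rw [← PrimeSpectrum.range_asIdeal]
  exact Set.infinite_range_of_injective fun _ _ ↦ PrimeSpectrum.ext
end

section
/- Let R be an infinite Dedekind domain with at most finitely many units, let K be its field of fractions, let L/K be a finite Galois extension of fields, and let O be the integral closure of R in L. If O is a unique factorization domain, then O contains infinitely many pairwise non-associate prime elements. -/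
/-- An infinite domain with finitely many units is not a field. -/
theorem not_isField_of_finite_units (R : Type*) [CommRing R] [IsDomain R] [Infinite R]
    [Finite Rˣ] : ¬ IsField R := by
  intro h
  let _ := h.toField
  have : Finite R := by
    refine Set.finite_univ_iff.mp
      (((Set.finite_range (fun u : Rˣ => (u : R))).insert 0).subset fun x _ => ?_)
    by_cases hx : x = 0
    · exact Or.inl hx
    · obtain ⟨y, hy⟩ := h.mul_inv_cancel hx
      exact Or.inr ⟨(IsUnit.of_mul_eq_one y hy).unit, rfl⟩
  exact not_finite R

/-- In a factorial domain of dimension at most one, every nonzero prime ideal is generated by a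
prime element. -/
theorem exists_prime_span_singleton_eq {A : Type*} [CommRing A] [IsDomain A]
    [UniqueFactorizationMonoid A] [Ring.DimensionLEOne A] {Q : Ideal A} (hQ : Q.IsPrime)
    (hQ0 : Q ≠ ⊥) : ∃ p : A, Prime p ∧ Ideal.span {p} = Q := by
  obtain ⟨p, hpQ, hp⟩ := hQ.exists_mem_prime_of_ne_bot hQ0
  have hspan : (Ideal.span {p}).IsPrime := (Ideal.span_singleton_prime hp.ne_zero).mpr hp
  have hmax := hspan.isMaximal (by simpa using hp.ne_zero)
  exact ⟨p, hp, hmax.eq_of_le hQ.ne_top ((Ideal.span_singleton_le_iff_mem Q).mpr hpQ)⟩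

/-- Let `R` be an infinite Dedekind domain with at most finitely many
units, `K` its field of fractions, `L/K` a finite Galois extension of fields, and
`O` the integral closure of `R` in `L`. If `O` is a UFD, then `O` contains
infinitely many pairwise non-associate prime elements. -/
theorem infinite_nonassociate_primes_of_integralClosure
    (R : Type*) [CommRing R] [IsDomain R] [IsDedekindDomain R] [Infinite R]
    (hu : Finite Rˣ)
    (K : Type*) [Field K] [Algebra R K] [IsFractionRing R K]
    (L : Type*) [Field L] [Algebra K L] [FiniteDimensional K L] [IsGalois K L]
    [Algebra R L] [IsScalarTower R K L]
    (hUFD : UniqueFactorizationMonoid (integralClosure R L)) :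
    ∃ S : Set (integralClosure R L), S.Infinite ∧ (∀ p ∈ S, Prime p) ∧
      ∀ p ∈ S, ∀ q ∈ S, p ≠ q → ¬ Associated p q := by
  have : Infinite (MaximalSpectrum R) := infinite_maximalSpectrum_of_finite_units R
  have : IsDedekindDomain (integralClosure R L) := integralClosure.isDedekindDomain R K L
  have hRL : Function.Injective (algebraMap R L) := by
    rw [IsScalarTower.algebraMap_eq R K L]
    exact (algebraMap K L).injective.comp (IsFractionRing.injective R K)
  have : FaithfulSMul R L := (faithfulSMul_iff_algebraMap_injective R L).mpr hRL
  have hover (M : MaximalSpectrum R) : ∃ p : integralClosure R L, Prime p ∧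
      (Ideal.span {p}).comap (algebraMap R (integralClosure R L)) = M.asIdeal := by
    have := M.isMaximal
    have hinj : Function.Injective (algebraMap R (integralClosure R L)) :=
      FaithfulSMul.algebraMap_injective R _
    obtain ⟨Q, hQ, hQM⟩ := Ideal.exists_ideal_over_maximal_of_isIntegral
      (S := integralClosure R L) M.asIdeal
      (by rw [(RingHom.injective_iff_ker_eq_bot _).mp hinj]; exact bot_le)
    have hQ0 : Q ≠ ⊥ := by
      rintro rfl
      rw [Ideal.comap_bot_of_injective _ hinj] at hQM
      exact Ring.ne_bot_of_isMaximal_of_not_isField M.isMaximal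
        (not_isField_of_finite_units R) hQM.symm
    obtain ⟨p, hp, rfl⟩ := exists_prime_span_singleton_eq hQ.isPrime hQ0
    exact ⟨p, hp, hQM⟩
  choose p hp hpM using hover
  have hassoc (M N : MaximalSpectrum R) (h : Associated (p M) (p N)) : M = N := by
    ext1
    rw [← hpM M, ← hpM N, Ideal.span_singleton_eq_span_singleton.mpr h]
  refine ⟨Set.range p,
    Set.infinite_range_of_injective fun M N h => hassoc M N (h ▸ .refl _), ?_, ?_⟩
  · rintro _ ⟨M, rfl⟩
    exact hp M
  · rintro _ ⟨M, rfl⟩ _ ⟨N, rfl⟩ hne h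
    exact hne (congrArg p (hassoc M N h))
end

section
/- Let A be an infinite integral domain with at most finitely many units. Then A has infinitely many maximal ideals. -/
/-- An infinite domain with finitely many units has zero Jacobson radical. -/
theorem jacobson_bot_eq_bot_of_finite_units
    (A : Type*) [CommRing A] [IsDomain A] [Infinite A] [Finite Aˣ] :
    Ideal.jacobson (⊥ : Ideal A) = ⊥ := by
  by_contra h
  obtain ⟨a, ha, ha0⟩ := Submodule.exists_mem_ne_zero_of_ne_bot h
  have hunit := Ideal.mem_jacobson_bot.mp ha
  refine not_injective_infinite_finite (fun y => (hunit y).unit) fun y z hyz => ?_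
  have hval := congrArg Units.val hyz
  simp only [IsUnit.unit_spec, add_left_inj] at hval
  exact mul_left_cancel₀ ha0 hval

/-- A field with finitely many units is finite. -/
theorem IsField.finite_of_finite_units {A : Type*} [CommRing A] [Finite Aˣ]
    (hA : IsField A) : Finite A := by
  refine Set.finite_univ_iff.mp (((Set.finite_range (Units.val (α := A))).insert 0).subset ?_)
  intro a _
  by_cases ha : a = 0
  · exact Or.inl ha
  · obtain ⟨b, hb⟩ := hA.mul_inv_cancel ha
    exact Or.inr (IsUnit.of_mul_eq_one b hb)

/-- An infinite integral domain with at most finitely many units has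
infinitely many maximal ideals. -/
theorem infinite_maximal_ideals_of_finite_units
    (A : Type*) [CommRing A] [IsDomain A] [Infinite A] (hu : Finite Aˣ) :
    {I : Ideal A | I.IsMaximal}.Infinite := by
  intro hfin
  have hprod : ∏ I ∈ hfin.toFinset, I = ⊥ := by
    rw [← le_bot_iff, ← jacobson_bot_eq_bot_of_finite_units A]
    refine Ideal.prod_le_inf.trans (le_sInf fun I hI => ?_)
    exact Finset.inf_le (f := fun I : Ideal A => I) (hfin.mem_toFinset.mpr hI.2)
  obtain ⟨I, hI, hI0⟩ := Finset.prod_eq_zero_iff.mp hprod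
  have hmax : I.IsMaximal := hfin.mem_toFinset.mp hI
  rw [hI0] at hmax
  have : Finite A := (Ring.isField_iff_maximal_bot.mpr hmax).finite_of_finite_units
  exact not_finite A
end

section
/- Let A be an infinite integral domain with at most finitely many units. Then A has infinitely many prime ideals. -/
/-- In a domain with finitely many prime ideals, some nonzero element lies in every nonzero
prime ideal. -/
theorem exists_ne_zero_mem_of_finite_primes {A : Type*} [CommRing A] [IsDomain A]
    (h : {I : Ideal A | I.IsPrime}.Finite) :
    ∃ x : A, x ≠ 0 ∧ ∀ P : Ideal A, P.IsPrime → P ≠ ⊥ → x ∈ P := by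
  have hne : ∀ P : Ideal A, ∃ y : A, y ≠ 0 ∧ (P ≠ ⊥ → y ∈ P) := by
    intro P
    by_cases hP : P = ⊥
    · exact ⟨1, one_ne_zero, fun h' => absurd hP h'⟩
    · obtain ⟨y, hy, hy0⟩ := Submodule.exists_mem_ne_zero_of_ne_bot hP
      exact ⟨y, hy0, fun _ => hy⟩
  choose y hy0 hy using hne
  refine ⟨∏ P ∈ h.toFinset, y P, Finset.prod_ne_zero_iff.mpr fun P _ => hy0 P, fun P hP hP0 => ?_⟩
  exact P.mem_of_dvd (Finset.dvd_prod_of_mem y (h.mem_toFinset.mpr hP)) (hy P hP0)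

/-- If `x` lies in every nonzero prime ideal, then every `1 + x * a` is zero or a unit. -/
theorem one_add_mul_eq_zero_or_isUnit {A : Type*} [CommRing A] {x : A}
    (hx : ∀ P : Ideal A, P.IsPrime → P ≠ ⊥ → x ∈ P) (a : A) :
    1 + x * a = 0 ∨ IsUnit (1 + x * a) := by
  by_contra! h
  obtain ⟨M, hM, hmem⟩ := exists_max_ideal_of_mem_nonunits h.2
  have hM0 : M ≠ ⊥ := by
    rintro rfl
    exact h.1 (Ideal.mem_bot.mp hmem)
  have hxa : x * a ∈ M := M.mul_mem_right a (hx M hM.isPrime hM0)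
  exact hM.ne_top ((Ideal.eq_top_iff_one M).mpr ((M.add_mem_iff_left hxa).mp hmem))

/-- An infinite integral domain with at most finitely many units has
infinitely many prime ideals. -/
theorem infinite_prime_ideals_of_finite_units
    (A : Type*) [CommRing A] [IsDomain A] [Infinite A] (hu : Finite Aˣ) :
    {I : Ideal A | I.IsPrime}.Infinite := by
  intro hfin
  obtain ⟨x, hx0, hx⟩ := exists_ne_zero_mem_of_finite_primes hfin
  have hinj : Function.Injective fun a : A => 1 + x * a :=
    (add_right_injective 1).comp (mul_right_injective₀ hx0)
  refine Set.infinite_range_of_injective hinj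
    (((Set.finite_range ((↑) : Aˣ → A)).insert 0).subset ?_)
  rintro _ ⟨a, rfl⟩
  exact one_add_mul_eq_zero_or_isUnit hx a
end
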